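/- arXiv:2209.06658 — 2 statements merged into one kernel-verified Lean document; each statement's English description precedes it below -/
import Mathlib

section
/- Let q = p^s with p an odd prime, n odd, a ∈ F_{q^n}*, b ∈ F_{q^n} with B = Tr(b/a) ≠ 0, χ₂ the quadratic character of F_{q^n}*, and τ as usual. Then the number of F_{q^n}-points on y² = a·x·Tr(x) + b equals q^n + q^{n−1}χ₂(b) − τ^{(n+1)s}·q^{(n−1)/2}·(χ₂(−a) + χ₂(−aB)). -/
/-- The number of `F_{q^n}`-rational points on the affine curve `y^d = a·x·Tr(x) + b`. -/
noncomputable def curveCard (Fq Fqn : Type) [Field Fq] [Field Fqn] [Fintype Fq] [Fintype Fqn]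
    [Algebra Fq Fqn] (d : ℕ) (a b : Fqn) : ℕ :=
  Nat.card {xy : Fqn × Fqn //
    xy.2 ^ d = a * xy.1 * algebraMap Fq Fqn (Algebra.trace Fq Fqn xy.1) + b}

/-- `τ = 1` if `p ≡ 1 (mod 4)`, `τ = i` if `p ≡ 3 (mod 4)`. -/
noncomputable def tauC (p : ℕ) : ℂ := if p % 4 = 1 then 1 else Complex.I

open Classical in
/-- The quadratic character of a finite field, with values in `ℂ`. -/
noncomputable def complexQuadraticChar (F : Type*) [Field F] [Fintype F] : MulChar F ℂ :=
  (quadraticChar F).ringHomComp (Int.castRingHom ℂ)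

lemma AddChar.map_finset_sum {A M ι : Type*} [AddCommMonoid A] [CommMonoid M] (ψ : AddChar A M)
    (s : Finset ι) (f : ι → A) : ψ (∑ i ∈ s, f i) = ∏ i ∈ s, ψ (f i) := by
  classical
  induction s using Finset.induction_on with
  | empty => simp
  | insert i s hi ih => rw [Finset.sum_insert hi, Finset.prod_insert hi, map_add_eq_mul, ih]

section QuadraticCharacter

variable {F : Type*} [Field F] [Fintype F]

lemma complexQuadraticChar_apply [DecidableEq F] (a : F) :
    complexQuadraticChar F a = (quadraticChar F a : ℂ) := by
  simp only [complexQuadraticChar, MulChar.ringHomComp_apply, eq_intCast]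
  congr!

lemma complexQuadraticChar_isQuadratic : (complexQuadraticChar F).IsQuadratic := by
  classical
  intro a
  rw [complexQuadraticChar_apply]
  rcases quadraticChar_isQuadratic F a with h | h | h <;> simp [h]

lemma complexQuadraticChar_ne_one (hF : ringChar F ≠ 2) : complexQuadraticChar F ≠ 1 := by
  classical
  obtain ⟨a, ha⟩ := quadraticChar_exists_neg_one' hF
  refine MulChar.ne_one_iff.mpr ⟨a, ?_⟩
  rw [complexQuadraticChar_apply, ha]
  norm_num

lemma complexQuadraticChar_of_isSquare {a : F} (ha : a ≠ 0) (h : IsSquare a) :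
    complexQuadraticChar F a = 1 := by
  classical
  rw [complexQuadraticChar_apply, (quadraticChar_one_iff_isSquare ha).mpr h, Int.cast_one]

lemma complexQuadraticChar_of_not_isSquare {a : F} (h : ¬IsSquare a) :
    complexQuadraticChar F a = -1 := by
  classical
  rw [complexQuadraticChar_apply, quadraticChar_neg_one_iff_not_isSquare.mpr h]
  simp

lemma complexQuadraticChar_sq {a : F} (ha : a ≠ 0) : complexQuadraticChar F a ^ 2 = 1 := by
  rw [← map_pow]
  exact complexQuadraticChar_of_isSquare (pow_ne_zero _ ha) ⟨a, sq a⟩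

lemma card_sqrts_eq_complexQuadraticChar [DecidableEq F] (hF : ringChar F ≠ 2) (a : F) :
    ((Finset.univ.filter fun x : F ↦ x ^ 2 = a).card : ℂ) = 1 + complexQuadraticChar F a := by
  have h := congrArg (Int.cast : ℤ → ℂ) (quadraticChar_card_sqrts hF a)
  rw [Int.cast_natCast, Int.cast_add, Int.cast_one, ← complexQuadraticChar_apply, add_comm] at h
  rw [← h]
  congr 2
  ext x
  simp

/-- A multiplicative character of order two of a finite field is the quadratic character. -/
lemma eq_complexQuadraticChar_of_orderOf_eq_two {χ : MulChar F ℂ} (hχ : orderOf χ = 2) :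
    χ = complexQuadraticChar F := by
  have hsq (a : F) (ha : a ≠ 0) : χ a ^ 2 = 1 := by
    rw [← MulChar.pow_apply' _ two_ne_zero, ← hχ, pow_orderOf_eq_one, MulChar.one_apply ha.isUnit]
  have hsquare (a : F) (ha : a ≠ 0) (h : IsSquare a) : χ a = 1 := by
    obtain ⟨r, rfl⟩ := h
    rw [map_mul, ← sq, hsq r (by rintro rfl; simp at ha)]
  have hne : χ ≠ 1 := by
    rintro rfl
    simp at hχ
  obtain ⟨u, hu⟩ := MulChar.ne_one_iff.mp hne
  have hu' : ¬IsSquare (u : F) := fun h ↦ hu (hsquare _ u.ne_zero h)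
  have hχu : χ u = -1 := (sq_eq_one_iff.mp (hsq _ u.ne_zero)).resolve_left hu
  ext a
  by_cases ha : IsSquare (a : F)
  · rw [hsquare _ a.ne_zero ha, complexQuadraticChar_of_isSquare a.ne_zero ha]
  · have hau : IsSquare ((a : F) * u) := by
      classical
      rw [← quadraticChar_one_iff_isSquare (mul_ne_zero a.ne_zero u.ne_zero), map_mul,
        quadraticChar_neg_one_iff_not_isSquare.mpr ha,
        quadraticChar_neg_one_iff_not_isSquare.mpr hu', neg_one_mul, neg_neg]
    have h := hsquare _ (mul_ne_zero a.ne_zero u.ne_zero) hau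
    rw [map_mul, hχu] at h
    rw [complexQuadraticChar_of_not_isSquare ha]
    linear_combination -h

/-- Summing a function of `x ^ 2` over `x`. -/
lemma sum_comp_sq (hF : ringChar F ≠ 2) (f : F → ℂ) :
    ∑ x, f (x ^ 2) = ∑ y, f y + ∑ y, complexQuadraticChar F y * f y := by
  classical
  rw [← Finset.sum_fiberwise Finset.univ (fun x : F ↦ x ^ 2), ← Finset.sum_add_distrib]
  refine Finset.sum_congr rfl fun y _ ↦ ?_
  rw [Finset.sum_congr rfl (g := fun _ ↦ f y) fun x hx ↦ by rw [(Finset.mem_filter.mp hx).2],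
    Finset.sum_const, nsmul_eq_mul, card_sqrts_eq_complexQuadraticChar hF]
  ring

lemma sum_addChar_sq (hF : ringChar F ≠ 2) {ψ : AddChar F ℂ} (hψ : ψ ≠ 1) :
    ∑ x, ψ (x ^ 2) = gaussSum (complexQuadraticChar F) ψ := by
  rw [sum_comp_sq hF (fun x ↦ ψ x), AddChar.sum_eq_zero_of_ne_one hψ, zero_add, gaussSum]

lemma sum_addChar_mul_sq (hF : ringChar F ≠ 2) {ψ : AddChar F ℂ} (hψ : ψ ≠ 1) {d : F}
    (hd : d ≠ 0) :
    ∑ x, ψ (d * x ^ 2) = complexQuadraticChar F d * gaussSum (complexQuadraticChar F) ψ := by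
  have h : ψ.mulShift d ≠ 1 := AddChar.IsPrimitive.of_ne_one hψ hd
  have h' := sum_addChar_sq hF h
  simp only [AddChar.mulShift_apply] at h'
  rw [h', ← gaussSum_mulShift _ ψ (Units.mk0 d hd), Units.val_mk0, ← mul_assoc, ← sq,
    complexQuadraticChar_sq hd, one_mul]

lemma sum_complexQuadraticChar_sq_add (hF : ringChar F ≠ 2) {B : F} (hB : B ≠ 0) :
    ∑ t, complexQuadraticChar F (t ^ 2 + B) = -1 := by
  set η := complexQuadraticChar F
  have hη : η ≠ 1 := complexQuadraticChar_ne_one hF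
  rw [sum_comp_sq hF (fun x ↦ η (x + B)),
    show ∑ y, η (y + B) = ∑ y, η y from Equiv.sum_comp (Equiv.addRight B) (fun x ↦ η x), MulChar.sum_eq_zero_of_ne_one hη, zero_add,
    ← Equiv.sum_comp (Equiv.mulLeft₀ (-B) (neg_ne_zero.mpr hB))]
  have hj := jacobiSum_nontrivial_inv hη
  rw [complexQuadraticChar_isQuadratic.inv, jacobiSum] at hj
  have : ∀ x, η (-B * x) * η (-B * x + B) = η (-1) * (η x * η (1 - x)) := fun x ↦ by
    rw [show -B * x = -1 * B * x by ring, show -1 * B * x + B = B * (1 - x) by ring]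
    simp only [map_mul]
    linear_combination η (-1) * (η x * η (1 - x)) * complexQuadraticChar_sq hB
  change ∑ x, η x * η (1 - x) = -η (-1) at hj
  change ∑ x, η (-B * x) * η (-B * x + B) = -1
  simp only [this, ← Finset.mul_sum, hj]
  linear_combination - complexQuadraticChar_sq (F := F) (neg_ne_zero.mpr one_ne_zero)

end QuadraticCharacter

section Extension

open Module

variable {K L : Type*} [Field K] [Fintype K] [Field L] [Fintype L] [Algebra K L]

lemma complexQuadraticChar_algebraMap (hn : Odd (finrank K L)) (c : K) :
    complexQuadraticChar L (algebraMap K L c) = complexQuadraticChar K c := by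
  by_cases hc : c = 0
  · rw [hc, map_zero, MulChar.map_zero, MulChar.map_zero]
  by_cases h : IsSquare c
  · rw [complexQuadraticChar_of_isSquare hc h,
      complexQuadraticChar_of_isSquare (by simpa using hc) (h.map _)]
  · rw [complexQuadraticChar_of_not_isSquare h, complexQuadraticChar_of_not_isSquare]
    intro hs
    have hs' := hs.map (Algebra.norm K)
    rw [Algebra.norm_algebraMap] at hs'
    obtain ⟨k, hk⟩ := hn
    rw [hk, pow_succ, pow_mul'] at hs'
    refine h ?_
    have := hs'.div (IsSquare.sq (c ^ k))
    rwa [mul_div_cancel_left₀ _ (pow_ne_zero _ (pow_ne_zero _ hc))] at this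

lemma det_frobenius_matrix_pow_card {n : ℕ} (hn : finrank K L = n) (hodd : Odd n)
    (v : Fin n → L) :
    (Matrix.of fun i j : Fin n ↦ v i ^ Fintype.card K ^ (j : ℕ)).det ^ Fintype.card K =
      (Matrix.of fun i j : Fin n ↦ v i ^ Fintype.card K ^ (j : ℕ)).det := by
  set M := Matrix.of fun i j : Fin n ↦ v i ^ Fintype.card K ^ (j : ℕ) with hM
  obtain ⟨m, rfl⟩ : ∃ m, n = m + 1 := ⟨n - 1, by have := hodd.pos; omega⟩
  have h : M.map (FiniteField.frobeniusAlgHom K L) = M.submatrix id (finRotate (m + 1)) := by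
    ext i j
    simp only [Matrix.map_apply, Matrix.submatrix_apply, id, hM, Matrix.of_apply,
      FiniteField.coe_frobeniusAlgHom, ← pow_mul, ← pow_succ]
    rcases eq_or_ne j (Fin.last m) with rfl | hj
    · rw [finRotate_last]
      simp only [Fin.val_last, Fin.val_zero, pow_zero, pow_one]
      rw [← hn, ← Module.card_eq_pow_finrank, FiniteField.pow_card]
    · rw [coe_finRotate_of_ne_last hj]
  have h' := congrArg Matrix.det h
  rw [Matrix.det_permute', sign_finRotate, add_tsub_cancel_right,
    (by rcases hodd with ⟨k, hk⟩; exact ⟨k, by omega⟩ : Even m).neg_one_pow] at h'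
  have h2 : (M.map (FiniteField.frobeniusAlgHom K L)).det = FiniteField.frobeniusAlgHom K L M.det :=
    ((FiniteField.frobeniusAlgHom K L).map_det M).symm
  rw [h2, FiniteField.coe_frobeniusAlgHom] at h'
  simpa using h'

/-- The discriminant of an extension of odd degree of finite fields is a square. -/
lemma isSquare_discr {n : ℕ} (hK : ringChar K ≠ 2) (hn : finrank K L = n) (hodd : Odd n)
    (v : Basis (Fin n) K L) : IsSquare (Algebra.discr K v) := by
  have hd : Algebra.discr K v ≠ 0 := Algebra.discr_not_zero_of_basis K v
  set M := Matrix.of fun i j : Fin n ↦ v i ^ Fintype.card K ^ (j : ℕ) with hM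
  have hsq : algebraMap K L (Algebra.discr K v) = M.det ^ 2 := by
    rw [Algebra.discr_def, RingHom.map_det, sq]
    nth_rewrite 3 [← Matrix.det_transpose]
    rw [← Matrix.det_mul]
    congr 1
    ext i j
    simp only [RingHom.mapMatrix_apply, Matrix.map_apply, Algebra.traceMatrix_apply,
      Algebra.traceForm_apply, FiniteField.algebraMap_trace_eq_sum_pow, Matrix.mul_apply,
      Matrix.transpose_apply, hM, Matrix.of_apply, hn, Finset.sum_range, mul_pow,
      Nat.card_eq_fintype_card]
  rw [FiniteField.isSquare_iff hK hd]
  have hM0 : M.det ≠ 0 := by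
    intro h0
    rw [h0, zero_pow two_ne_zero, map_eq_zero] at hsq
    exact hd hsq
  apply (algebraMap K L).injective
  rw [map_pow, hsq, map_one, ← pow_mul]
  apply mul_right_cancel₀ hM0
  rw [← pow_succ, Nat.two_mul_odd_div_two (FiniteField.odd_card_of_char_ne_two hK),
    Nat.sub_add_cancel Fintype.card_pos, one_mul]
  exact det_frobenius_matrix_pow_card hn hodd v

lemma sum_addChar_trace_sq (hK : ringChar K ≠ 2) (hodd : Odd (finrank K L))
    {ψ : AddChar K ℂ} (hψ : ψ ≠ 1) :
    ∑ x : L, ψ (Algebra.trace K L (x ^ 2)) =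
      gaussSum (complexQuadraticChar K) ψ ^ finrank K L := by
  classical
  have : Invertible (2 : K) := invertibleOfNonzero (Ring.two_ne_zero hK)
  obtain ⟨v, hv⟩ := LinearMap.BilinForm.exists_orthogonal_basis
    (LinearMap.BilinForm.isSymm_iff.mp (Algebra.traceForm_isSymm K (S := L)))
  have hoff (i j) (hij : i ≠ j) : Algebra.trace K L (v i * v j) = 0 := hv hij
  set d : Fin (finrank K L) → K := fun i ↦ Algebra.trace K L (v i * v i) with hd
  have hdisc : Algebra.discr K v = ∏ i, d i := by
    rw [Algebra.discr_def, ← Matrix.det_diagonal]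
    congr 1
    ext i j
    rw [Algebra.traceMatrix_apply, Algebra.traceForm_apply, Matrix.diagonal_apply]
    split_ifs with h
    · rw [h]
    · exact hoff i j h
  have hdisc0 : ∏ i, d i ≠ 0 := hdisc ▸ Algebra.discr_not_zero_of_basis K v
  have hd0 (i) : d i ≠ 0 := Finset.prod_ne_zero_iff.mp hdisc0 i (Finset.mem_univ i)
  have htr (c : Fin (finrank K L) → K) :
      Algebra.trace K L (v.equivFun.symm c ^ 2) = ∑ i, d i * c i ^ 2 := by
    rw [Basis.equivFun_symm_apply, sq, Finset.sum_mul_sum, map_sum]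
    refine Finset.sum_congr rfl fun i _ ↦ ?_
    rw [map_sum, Finset.sum_eq_single i]
    · rw [smul_mul_smul_comm, map_smul, smul_eq_mul, hd]
      ring
    · intro j _ hij
      rw [smul_mul_smul_comm, map_smul, hoff i j hij.symm, smul_zero]
    · simp
  rw [← Equiv.sum_comp v.equivFun.symm.toEquiv]
  simp only [LinearEquiv.coe_toEquiv, htr, AddChar.map_finset_sum]
  rw [← Fintype.piFinset_univ, ← Finset.prod_univ_sum (fun _ ↦ Finset.univ)
    (fun i t ↦ ψ (d i * t ^ 2))]
  simp only [sum_addChar_mul_sq hK hψ (hd0 _), Finset.prod_mul_distrib, ← map_prod]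
  rw [← hdisc, complexQuadraticChar_of_isSquare (hdisc ▸ hdisc0) (isSquare_discr hK rfl hodd v)]
  simp

lemma card_trace_eq_zero [DecidableEq K] :
    (Finset.univ.filter fun x : L ↦ Algebra.trace K L x = 0).card =
      Fintype.card K ^ (finrank K L - 1) := by
  classical
  have hker := Module.card_eq_pow_finrank (K := K) (V := LinearMap.ker (Algebra.trace K L))
  have hrank := (Algebra.trace K L).finrank_range_add_finrank_ker
  rw [LinearMap.range_eq_top.mpr (Algebra.trace_surjective K L), finrank_top, finrank_self] at hrank
  rw [show finrank K L - 1 = finrank K (LinearMap.ker (Algebra.trace K L)) by omega, ← hker,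
    Fintype.card_subtype]
  simp

/-- The quadratic character sums over the fibers of the trace are proportional. -/
lemma sum_trace_fiber_eq [DecidableEq K] (hK : ringChar K ≠ 2) (hodd : Odd (finrank K L)) (c : K) :
    ∑ z : L with Algebra.trace K L z = c, complexQuadraticChar L z =
      complexQuadraticChar K c *
        ∑ z : L with Algebra.trace K L z = 1, complexQuadraticChar L z := by
  have key (u : K) (hu : u ≠ 0) (c : K) :
      ∑ z : L with Algebra.trace K L z = u * c, complexQuadraticChar L z =
        complexQuadraticChar K u *
          ∑ z : L with Algebra.trace K L z = c, complexQuadraticChar L z := by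
    have hu' : algebraMap K L u ≠ 0 := by simpa using hu
    rw [Finset.mul_sum]
    symm
    refine Finset.sum_equiv (Equiv.mulLeft₀ _ hu') (fun z ↦ ?_) (fun z _ ↦ ?_)
    · simp [← Algebra.smul_def, hu]
    · rw [Equiv.mulLeft₀_apply, map_mul, complexQuadraticChar_algebraMap hodd]
  rcases eq_or_ne c 0 with rfl | hc
  · obtain ⟨u, hu⟩ := MulChar.ne_one_iff.mp (complexQuadraticChar_ne_one hK)
    have h := key u u.ne_zero 0
    rw [mul_zero] at h
    rw [MulChar.map_zero, zero_mul]
    exact eq_zero_of_mul_eq_self_left hu h.symm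
  · simpa using key c hc 1

/-- The quadratic character sum over the elements of trace one. -/
lemma sum_trace_eq_one [DecidableEq K] (hK : ringChar K ≠ 2) (hodd : Odd (finrank K L)) :
    ∑ z : L with Algebra.trace K L z = 1, complexQuadraticChar L z =
      (complexQuadraticChar K (-1) * Fintype.card K) ^ ((finrank K L - 1) / 2) := by
  have hL : ringChar L ≠ 2 := by rwa [← Algebra.ringChar_eq K L]
  obtain ⟨ψ, hψ⟩ : ∃ ψ : AddChar K ℂ, ψ ≠ 1 := by
    obtain ⟨ψ, hψ⟩ := AddChar.exists_apply_ne_zero.mpr (one_ne_zero (α := K))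
    exact ⟨ψ, fun h ↦ hψ (by rw [h, AddChar.one_apply])⟩
  set g := gaussSum (complexQuadraticChar K) ψ with hg
  have hg2 : g ^ 2 = complexQuadraticChar K (-1) * Fintype.card K :=
    gaussSum_sq (complexQuadraticChar_ne_one hK) complexQuadraticChar_isQuadratic
      (AddChar.IsPrimitive.of_ne_one hψ)
  have hg0 : g ≠ 0 := by
    intro h
    rw [h, zero_pow two_ne_zero] at hg2
    have h1 := complexQuadraticChar_sq (F := K) (neg_ne_zero.mpr one_ne_zero)
    rcases mul_eq_zero.mp hg2.symm with h | h
    · rw [h] at h1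
      norm_num at h1
    · exact Fintype.card_ne_zero (Nat.cast_eq_zero.mp h)
  set Ψ : AddChar L ℂ := ψ.compAddMonoidHom (Algebra.trace K L).toAddMonoidHom with hΨ
  have hΨ1 : Ψ ≠ 1 := by
    obtain ⟨c, hc⟩ := AddChar.ne_one_iff.mp hψ
    obtain ⟨x, rfl⟩ := Algebra.trace_surjective K L c
    exact AddChar.ne_one_iff.mpr ⟨x, hc⟩
  have h1 : gaussSum (complexQuadraticChar L) Ψ = g ^ finrank K L := by
    rw [← sum_addChar_sq hL hΨ1, ← sum_addChar_trace_sq hK hodd hψ]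
    rfl
  have h2 : gaussSum (complexQuadraticChar L) Ψ =
      g * ∑ z : L with Algebra.trace K L z = 1, complexQuadraticChar L z := by
    rw [gaussSum, ← Finset.sum_fiberwise Finset.univ (Algebra.trace K L), hg, gaussSum,
      Finset.sum_mul]
    refine Finset.sum_congr rfl fun c _ ↦ ?_
    rw [mul_right_comm, ← sum_trace_fiber_eq hK hodd, Finset.sum_mul]
    refine Finset.sum_congr rfl fun z hz ↦ ?_
    rw [← (Finset.mem_filter.mp hz).2]
    rfl
  rw [← hg2, ← pow_mul]
  apply mul_left_cancel₀ hg0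
  obtain ⟨k, hk⟩ := hodd
  rw [← h2, h1, ← pow_succ', hk]
  congr 1
  omega

lemma sum_mul_trace_add (hK : ringChar K ≠ 2) (hodd : Odd (finrank K L)) (b : L)
    (hb : Algebra.trace K L b ≠ 0) :
    ∑ x : L, complexQuadraticChar L (x * algebraMap K L (Algebra.trace K L x) + b) =
      (Fintype.card K : ℂ) ^ (finrank K L - 1) * complexQuadraticChar L b -
        (1 + complexQuadraticChar K (Algebra.trace K L b)) *
          (complexQuadraticChar K (-1) * Fintype.card K) ^ ((finrank K L - 1) / 2) := by
  have : DecidableEq K := Classical.decEq K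
  set B := Algebra.trace K L b with hB
  rw [← Finset.sum_fiberwise Finset.univ (Algebra.trace K L),
    ← Finset.add_sum_erase _ _ (Finset.mem_univ (0 : K)), ← sum_trace_eq_one hK hodd]
  set J := ∑ z : L with Algebra.trace K L z = 1, complexQuadraticChar L z
  have h0 : ∑ x : L with Algebra.trace K L x = 0,
      complexQuadraticChar L (x * algebraMap K L (Algebra.trace K L x) + b) =
        (Fintype.card K : ℂ) ^ (finrank K L - 1) * complexQuadraticChar L b := by
    rw [Finset.sum_congr rfl (g := fun _ ↦ complexQuadraticChar L b) fun x hx ↦ by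
      rw [(Finset.mem_filter.mp hx).2, map_zero, mul_zero, zero_add],
      Finset.sum_const, nsmul_eq_mul, card_trace_eq_zero (K := K), Nat.cast_pow]
  have ht (t : K) (ht : t ∈ Finset.univ.erase (0 : K)) : ∑ x : L with Algebra.trace K L x = t,
      complexQuadraticChar L (x * algebraMap K L (Algebra.trace K L x) + b) =
        complexQuadraticChar K (t ^ 2 + B) * J := by
    have ht0 : t ≠ 0 := Finset.ne_of_mem_erase ht
    have ht' : algebraMap K L t ≠ 0 := by simpa using ht0
    rw [← sum_trace_fiber_eq hK hodd]
    refine Finset.sum_equiv ((Equiv.mulLeft₀ _ ht').trans (Equiv.addRight b)) (fun z ↦ ?_)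
      (fun z hz ↦ ?_)
    · simp [← Algebra.smul_def, ht0, sq, hB]
    · rw [(Finset.mem_filter.mp hz).2, mul_comm]
      rfl
  have hsum := sum_complexQuadraticChar_sq_add hK hb
  rw [← Finset.add_sum_erase _ _ (Finset.mem_univ (0 : K)), zero_pow two_ne_zero, zero_add] at hsum
  rw [h0, Finset.sum_congr rfl ht, ← Finset.sum_mul]
  linear_combination J * hsum

end Extension

lemma curveCard_two_eq_sum (Fq Fqn : Type) [Field Fq] [Field Fqn] [Fintype Fq] [Fintype Fqn]
    [Algebra Fq Fqn] (h2 : ringChar Fqn ≠ 2) (a b : Fqn) :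
    (curveCard Fq Fqn 2 a b : ℂ) = Fintype.card Fqn + ∑ x : Fqn,
      complexQuadraticChar Fqn (a * x * algebraMap Fq Fqn (Algebra.trace Fq Fqn x) + b) := by
  classical
  let f : Fqn → Fqn := fun x ↦ a * x * algebraMap Fq Fqn (Algebra.trace Fq Fqn x) + b
  have h : curveCard Fq Fqn 2 a b =
      ∑ x : Fqn, (Finset.univ.filter fun y : Fqn ↦ y ^ 2 = f x).card := by
    rw [curveCard, Nat.card_eq_fintype_card, Fintype.card_subtype,
      Finset.card_eq_sum_card_fiberwise (f := Prod.fst) (t := Finset.univ) (by simp)]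
    refine Finset.sum_congr rfl fun x _ ↦ ?_
    refine Finset.card_bij' (fun xy _ ↦ xy.2) (fun y _ ↦ (x, y)) ?_ ?_ ?_ ?_
    · rintro ⟨x', y⟩ hxy
      simp only [Finset.mem_filter, Finset.mem_univ, true_and] at hxy ⊢
      obtain ⟨hxy, rfl⟩ := hxy
      exact hxy
    · intro y hy
      simpa using hy
    · rintro ⟨x', y⟩ hxy
      simp only [Finset.mem_filter] at hxy
      rw [hxy.2]
    · simp
  rw [h, Nat.cast_sum]
  simp only [card_sqrts_eq_complexQuadraticChar h2, Finset.sum_add_distrib, Finset.sum_const,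
    Finset.card_univ, nsmul_eq_mul, mul_one, f]

lemma tauC_pow_two_mul {p s : ℕ} (hp : Odd p) {F : Type*} [Field F] [Fintype F]
    (hF : ringChar F ≠ 2) (hcard : Fintype.card F = p ^ s) :
    tauC p ^ (2 * s) = complexQuadraticChar F (-1) := by
  classical
  rw [complexQuadraticChar_apply, quadraticChar_neg_one hF, hcard, pow_mul, Nat.cast_pow, map_pow,
    Int.cast_pow]
  congr 1
  rw [tauC]
  rcases Nat.odd_mod_four_iff.mp (Nat.odd_iff.mp hp) with h | h
  · rw [if_pos h, ZMod.χ₄_nat_one_mod_four h]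
    simp
  · rw [if_neg (by omega), ZMod.χ₄_nat_three_mod_four h]
    simp

theorem curve_d2_n_odd_B_ne_zero (p s n : ℕ) [Fact p.Prime] (hp : Odd p) (hs : 0 < s) (hn : 0 < n)
    (q : ℕ) (hq : q = p ^ s)
    (Fq Fqn : Type) [Field Fq] [Field Fqn] [Fintype Fq] [Fintype Fqn] [Algebra Fq Fqn]
    (hcard : Fintype.card Fq = q) (hcardn : Fintype.card Fqn = q ^ n)
    (a : Fqn) (ha : a ≠ 0) (b : Fqn)
    (χ₂ : MulChar Fqn ℂ) (hχ : orderOf χ₂ = 2)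
    (hnodd : Odd n) (B : Fq) (hB : B = Algebra.trace Fq Fqn (b / a)) (hBne : B ≠ 0) :
    (curveCard Fq Fqn 2 a b : ℂ)
      = (q : ℂ) ^ n + (q : ℂ) ^ (n - 1) * χ₂ b
        - tauC p ^ ((n + 1) * s) * (q : ℂ) ^ ((n - 1) / 2) *
            (χ₂ (-a) + χ₂ (-a * algebraMap Fq Fqn B)) := by
  have hrank : Module.finrank Fq Fqn = n := by
    have h := Module.card_eq_pow_finrank (K := Fq) (V := Fqn)
    rw [hcardn, hcard] at h
    exact (Nat.pow_right_injective (hcard ▸ Fintype.one_lt_card) h).symm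
  have hq2 : ringChar Fq ≠ 2 := by
    intro h
    have := FiniteField.even_card_of_char_two h
    rw [hcard, hq] at this
    exact Nat.not_even_iff_odd.mpr hp.pow (Nat.even_iff.mpr this)
  have hqn2 : ringChar Fqn ≠ 2 := by rwa [← Algebra.ringChar_eq Fq Fqn]
  have hodd : Odd (Module.finrank Fq Fqn) := hrank ▸ hnodd
  have hτ := tauC_pow_two_mul hp hq2 (hcard.trans hq)
  rw [eq_complexQuadraticChar_of_orderOf_eq_two hχ, curveCard_two_eq_sum Fq Fqn hqn2, hcardn]
  have hfactor (x : Fqn) : complexQuadraticChar Fqn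
      (a * x * algebraMap Fq Fqn (Algebra.trace Fq Fqn x) + b) = complexQuadraticChar Fqn a *
        complexQuadraticChar Fqn (x * algebraMap Fq Fqn (Algebra.trace Fq Fqn x) + b / a) := by
    rw [← map_mul, mul_add, mul_div_cancel₀ _ ha, mul_assoc]
  simp only [hfactor, ← Finset.mul_sum]
  rw [sum_mul_trace_add hq2 hodd _ (hB ▸ hBne), ← hB, hrank, hcard]
  have hab : complexQuadraticChar Fqn a * complexQuadraticChar Fqn (b / a) =
      complexQuadraticChar Fqn b := by rw [← map_mul, mul_div_cancel₀ _ ha]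
  have hneg : complexQuadraticChar Fqn (-1) = complexQuadraticChar Fq (-1) := by
    rw [← complexQuadraticChar_algebraMap hodd, map_neg (algebraMap Fq Fqn), map_one]
  have hsq : complexQuadraticChar Fq (-1) ^ 2 = 1 :=
    complexQuadraticChar_sq (neg_ne_zero.mpr one_ne_zero)
  obtain ⟨k, rfl⟩ := hnodd
  rw [show (2 * k + 1 + 1) * s = 2 * s * (k + 1) by ring, pow_mul, hτ, ← hab,
    show -a = -1 * a by ring, map_mul, map_mul, map_mul, complexQuadraticChar_algebraMap hodd, hneg,
    show (2 * k + 1 - 1) / 2 = k by omega]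
  push_cast
  linear_combination (complexQuadraticChar Fq (-1) ^ k * (q : ℂ) ^ k *
    complexQuadraticChar Fqn a * (1 + complexQuadraticChar Fq B)) * hsq
end

section
/- Let p be an odd prime, q = p^s, and suppose d > 2 divides q^n − 1, d divides p^r + 1 where 2r divides ns, and set u = (p^r+1)/d, ε = (−1)^{ns/(2r)}. Let χ_d be a multiplicative character of F_{q^n}* of exact order d. Then for every j not divisible by d, the Gauss sum satisfies G_n(χ_d^j) = −(−1)^{ns(uj+1)/(2r)}·q^{n/2}; in particular ε^{uj+1}·G_n(χ_d^j) = −q^{n/2} is real (the Gauss sum is pure). -/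
/-- The canonical additive character `ψ(x) = exp(2πi·Tr_{F/F_p}(x)/p)`. -/
noncomputable def psiC (p : ℕ) [Fact p.Prime] (F : Type) [Field F] [Fintype F] [CharP F p]
    (x : F) : ℂ :=
  letI : Algebra (ZMod p) F := ZMod.algebra F p
  Complex.exp (2 * Real.pi * Complex.I * ((Algebra.trace (ZMod p) F x).val : ℂ) / p)

/-- The Gauss sum `G(χ) = Σ_x χ(x)·ψ(x)` (recall `χ(0)=0`). -/
noncomputable def gaussSum' (p : ℕ) [Fact p.Prime] (F : Type) [Field F] [Fintype F] [CharP F p]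
    (χ : MulChar F ℂ) : ℂ :=
  ∑ x : F, χ x * psiC p F x

open Finset

section FiniteField

variable {F : Type*} [Field F] [Fintype F]

theorem exists_isPrimitiveRoot_card_sub_one (F : Type*) [Field F] [Fintype F] :
    ∃ g : F, IsPrimitiveRoot g (Fintype.card F - 1) := by
  classical
  obtain ⟨g, hg⟩ := IsCyclic.exists_generator (α := Fˣ)
  refine ⟨g, ?_⟩
  rw [IsPrimitiveRoot.coe_units_iff, ← Fintype.card_units, ← Nat.card_eq_fintype_card,
    ← orderOf_eq_card_of_forall_mem_zpowers hg]
  exact IsPrimitiveRoot.orderOf g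

theorem card_sub_one_pos (F : Type*) [Field F] [Fintype F] : 0 < Fintype.card F - 1 :=
  Nat.sub_pos_of_lt Fintype.one_lt_card

/-- A nonempty fibre of `y ↦ y ^ k` over a nonzero point has `k` elements when `k ∣ #F - 1`. -/
theorem card_filter_pow_eq_pow [DecidableEq F] {k : ℕ} (hk : k ∣ Fintype.card F - 1) {y₀ : F}
    (hy₀ : y₀ ≠ 0) : #{y : F | y ^ k = y₀ ^ k} = k := by
  obtain ⟨g, hg⟩ := exists_isPrimitiveRoot_card_sub_one F
  obtain ⟨m, hm⟩ := hk
  have hpos := card_sub_one_pos F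
  have hk0 : 0 < k := Nat.pos_of_mul_pos_right (hm ▸ hpos)
  have hζ : IsPrimitiveRoot (g ^ m) k := hg.pow hpos (by rw [hm, mul_comm])
  refine Eq.trans ?_ hζ.card_nthRootsFinset
  refine card_bij' (fun y _ => y / y₀) (fun z _ => z * y₀) ?_ ?_ ?_ ?_
  · intro y hy
    simp only [mem_filter, mem_univ, true_and] at hy
    rw [Polynomial.mem_nthRootsFinset hk0, div_pow, hy, div_self (pow_ne_zero _ hy₀)]
  · intro z hz
    rw [Polynomial.mem_nthRootsFinset hk0] at hz
    simp [mul_pow, hz]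
  · intro y _
    exact div_mul_cancel₀ y hy₀
  · intro z _
    exact mul_div_cancel_right₀ z hy₀

theorem IsPrimitiveRoot.pow_half_eq_neg_one {R : Type*} [CommRing R] [IsDomain R] {g : R} {m : ℕ}
    (hg : IsPrimitiveRoot g (2 * m)) (hm : 0 < m) : g ^ m = -1 :=
  (hg.pow (by positivity) (mul_comm 2 m)).eq_neg_one_of_two_right

/-- If `Q ^ 2 - 1` divides `#F - 1`, then `-1` is a `(Q + 1)`-st power in `F`. -/
theorem exists_pow_eq_neg_one {Q M : ℕ} (hQ : Odd Q) (hcard : Fintype.card F - 1 = M * (Q ^ 2 - 1)) :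
    ∃ z : F, z ≠ 0 ∧ z ^ (Q + 1) = -1 := by
  obtain ⟨g, hg⟩ := exists_isPrimitiveRoot_card_sub_one F
  obtain ⟨h, rfl⟩ := hQ
  have hpos := card_sub_one_pos F
  have e : Fintype.card F - 1 = 2 * (M * h * (2 * h + 1 + 1)) := by
    rw [hcard, show (2 * h + 1) ^ 2 - 1 = 2 * h * (2 * h + 1 + 1) by
      rw [Nat.sub_eq_iff_eq_add (Nat.one_le_pow _ _ (by omega))]; ring]
    ring
  rw [e] at hg hpos
  refine ⟨g ^ (M * h), pow_ne_zero _ (hg.ne_zero hpos.ne'), ?_⟩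
  rw [← pow_mul]
  exact hg.pow_half_eq_neg_one (by omega)

end FiniteField

section PowerSum

variable {F : Type*} [Field F] [Fintype F] [DecidableEq F]

/-- The sum `∑ x, ψ (a * x ^ (Q + 1))`. -/
noncomputable def hermitianSum (ψ : AddChar F ℂ) (Q : ℕ) (a : F) : ℂ := ∑ x, ψ (a * x ^ (Q + 1))

/-- The solutions of `a ^ (Q - 1) * y ^ (Q ^ 2 - 1) = -1`. For `a ≠ 0` these are the nonzero
elements of the radical of the form `x ↦ a * x ^ (Q + 1)`. -/
def radicalUnits (Q : ℕ) (a : F) : Finset F := {y | a ^ (Q - 1) * y ^ (Q ^ 2 - 1) = -1}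

variable {ψ : AddChar F ℂ} {p r Q M : ℕ}

theorem card_radicalUnits (hQ : 1 < Q) (hcard : Fintype.card F - 1 = M * (Q ^ 2 - 1)) (a : F) :
    #(radicalUnits Q a) = 0 ∨ #(radicalUnits Q a) = Q ^ 2 - 1 := by
  have h1 : 1 < Q ^ 2 := Nat.one_lt_pow two_ne_zero hQ
  rcases (radicalUnits Q a).eq_empty_or_nonempty with h | ⟨y₀, h⟩
  · simp [h]
  right
  simp only [radicalUnits, mem_filter, mem_univ, true_and] at h
  have ha : a ^ (Q - 1) ≠ 0 := by rintro h0; simp [h0] at h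
  have hy : y₀ ≠ 0 := by
    rintro rfl
    rw [zero_pow (by omega)] at h
    simp at h
  rw [← card_filter_pow_eq_pow (k := Q ^ 2 - 1) (hcard ▸ dvd_mul_left _ _) hy, radicalUnits]
  congr 1
  ext y
  simp only [mem_filter, mem_univ, true_and]
  rw [← h, mul_right_inj' ha]

theorem radical_eq_insert (hQ : 1 < Q) {a : F} (ha : a ≠ 0) :
    ({y | a ^ Q * y ^ Q ^ 2 + a * y = 0} : Finset F) = insert 0 (radicalUnits Q a) := by
  have h1 : 1 < Q ^ 2 := Nat.one_lt_pow two_ne_zero hQ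
  ext y
  simp only [mem_filter, mem_univ, true_and, mem_insert, radicalUnits]
  have e : a ^ Q * y ^ Q ^ 2 + a * y = a * y * (a ^ (Q - 1) * y ^ (Q ^ 2 - 1) + 1) := by
    obtain ⟨k, hk⟩ : ∃ k, Q = k + 1 := ⟨Q - 1, by omega⟩
    obtain ⟨l, hl⟩ : ∃ l, Q ^ 2 = l + 1 := ⟨Q ^ 2 - 1, by omega⟩
    rw [hl, hk, Nat.add_sub_cancel, Nat.add_sub_cancel]
    ring
  rw [e, mul_eq_zero, mul_eq_zero, add_eq_zero_iff_eq_neg]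
  simp [ha]

variable [Fact p.Prime] [CharP F p]

theorem hermitianSum_sq (hp : Odd p) (hr : 0 < r) (hQr : Q = p ^ r)
    (hcard : Fintype.card F - 1 = M * (Q ^ 2 - 1)) (hψ : ψ.IsPrimitive)
    (hfrob : ∀ x, ψ (x ^ Q) = ψ x) {a : F} (ha : a ≠ 0) :
    hermitianSum ψ Q a ^ 2 = Fintype.card F * (1 + #(radicalUnits Q a)) := by
  have hQodd : Odd Q := hQr ▸ hp.pow
  have hQ1 : 1 < Q := hQr ▸ Nat.one_lt_pow hr.ne' (Fact.out : p.Prime).one_lt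
  have hadd (x y : F) : (x + y) ^ Q = x ^ Q + y ^ Q := by rw [hQr]; exact add_pow_char_pow x y p r
  have h2 : (2 : F) ≠ 0 := by
    intro h
    have h' : p ∣ 2 := (CharP.cast_eq_zero_iff F p 2).1 (by exact_mod_cast h)
    rw [Nat.prime_dvd_prime_iff_eq Fact.out Nat.prime_two] at h'
    subst h'
    exact absurd hp (by decide)
  have hanti {t : F} (ht : t ^ Q = -t) : ψ t = 1 := by
    have h2Q : (2 : F) ^ Q = 2 := by
      rw [← one_add_one_eq_two, hadd, one_pow]
    have h : (t / 2) ^ Q = -(t / 2) := by rw [div_pow, ht, h2Q, neg_div]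
    calc ψ t = ψ (t / 2 + t / 2) := by rw [← two_mul, mul_div_cancel₀ _ h2]
      _ = ψ (t / 2) * ψ (-(t / 2)) := by rw [ψ.map_add_eq_mul, ← h, hfrob]
      _ = 1 := by rw [← ψ.map_add_eq_mul, add_neg_cancel, ψ.map_zero_eq_one]
  have hneg : hermitianSum ψ Q a = ∑ x, ψ (-(a * x ^ (Q + 1))) := by
    obtain ⟨z, hz0, hz⟩ := exists_pow_eq_neg_one (F := F) hQodd hcard
    rw [hermitianSum, ← Equiv.sum_comp (Equiv.mulLeft₀ z hz0)]
    simp [mul_pow, hz]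
  have hsum (y : F) : ∑ x, ψ (a * (x + y) ^ (Q + 1)) * ψ (-(a * x ^ (Q + 1))) =
      if a ^ Q * y ^ Q ^ 2 + a * y = 0 then (Fintype.card F : ℂ) else 0 := by
    have hbij : Function.Bijective (fun x : F => x ^ Q) := by
      subst hQr
      exact (iterateFrobenius F p r).injective.bijective_of_finite
    have key (x : F) : ψ (a * (x + y) ^ (Q + 1)) * ψ (-(a * x ^ (Q + 1))) =
        ψ (a * y ^ (Q + 1)) * ψ (x ^ Q * (a ^ Q * y ^ Q ^ 2 + a * y)) := by
      have e : a * (x + y) ^ (Q + 1) + -(a * x ^ (Q + 1)) =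
          a * y ^ (Q + 1) + (x ^ Q * (a * y) + x * (a * y ^ Q)) := by
        rw [pow_succ, hadd]; ring
      rw [← ψ.map_add_eq_mul, e, ψ.map_add_eq_mul, ψ.map_add_eq_mul, ← hfrob (x * (a * y ^ Q)),
        ← ψ.map_add_eq_mul]
      congr 2
      ring
    simp_rw [key]
    rw [← mul_sum, hbij.sum_comp (fun x => ψ (x * (a ^ Q * y ^ Q ^ 2 + a * y))),
      AddChar.sum_mulShift _ hψ]
    split_ifs with h
    · rw [hanti, one_mul]
      rw [mul_pow, ← pow_mul, show (Q + 1) * Q = Q ^ 2 + Q by ring, pow_add, ← mul_assoc,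
        eq_neg_of_add_eq_zero_left h]
      ring
    · simp
  calc hermitianSum ψ Q a ^ 2
      = ∑ x, ∑ y, ψ (a * (x + y) ^ (Q + 1)) * ψ (-(a * x ^ (Q + 1))) := by
        rw [sq]
        nth_rewrite 2 [hneg]
        rw [mul_comm, sum_mul]
        refine sum_congr rfl fun x _ => ?_
        rw [← sum_mul, mul_comm, hermitianSum,
          ← Equiv.sum_comp (Equiv.addLeft x)]
        rfl
    _ = Fintype.card F * (1 + #(radicalUnits Q a)) := by
        rw [sum_comm]
        simp_rw [hsum]
        rw [← sum_filter, radical_eq_insert hQ1 ha, sum_const, card_insert_of_notMem, nsmul_eq_mul]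
        · push_cast; ring
        · have h1 : 1 < Q ^ 2 := Nat.one_lt_pow two_ne_zero hQ1
          simp [radicalUnits, show Q ^ 2 - 1 ≠ 0 by omega]

theorem exists_isIntegral_hermitianSum_eq (hQ : Q + 1 ∣ Fintype.card F - 1) (a : F) :
    ∃ w : ℂ, IsIntegral ℤ w ∧ hermitianSum ψ Q a = 1 + (Q + 1) * w := by
  have hint (x : F) : IsIntegral ℤ (ψ x) := by
    refine IsIntegral.of_pow (Fintype.card_pos (α := F)) ?_
    rw [← ψ.map_nsmul_eq_pow, nsmul_eq_mul, FiniteField.cast_card_eq_zero, zero_mul, ψ.map_zero_eq_one]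
    exact isIntegral_one
  refine ⟨∑ t ∈ (univ.erase (0 : F)).image (· ^ (Q + 1)), ψ (a * t),
    IsIntegral.sum _ fun t _ => hint _, ?_⟩
  rw [hermitianSum, ← add_sum_erase _ _ (mem_univ 0), zero_pow (Nat.succ_ne_zero Q), mul_zero,
    ψ.map_zero_eq_one, sum_comp (fun t => ψ (a * t)) (· ^ (Q + 1)), mul_sum]
  congr 1
  refine sum_congr rfl fun t ht => ?_
  obtain ⟨y, hy, rfl⟩ := mem_image.1 ht
  have hy0 : y ≠ 0 := (mem_erase.1 hy).1
  have hfib : #{x ∈ univ.erase (0 : F) | x ^ (Q + 1) = y ^ (Q + 1)} = Q + 1 := by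
    refine Eq.trans ?_ (card_filter_pow_eq_pow hQ hy0)
    congr 1
    ext x
    simp only [mem_filter, mem_erase, mem_univ, true_and, and_true, and_iff_right_iff_imp]
    rintro hx rfl
    rw [zero_pow (Nat.succ_ne_zero Q)] at hx
    exact pow_ne_zero _ hy0 hx.symm
  rw [hfib, nsmul_eq_mul]
  push_cast
  rfl

/-- An integer value `± Q ^ k` of the power sum is pinned down by its residue modulo `Q + 1`. -/
theorem hermitianSum_eq_neg_pow (hQ1 : 1 < Q) (hQ : Q + 1 ∣ Fintype.card F - 1) {a : F} {k : ℕ}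
    (h : hermitianSum ψ Q a ^ 2 = ((Q : ℂ) ^ k) ^ 2) : hermitianSum ψ Q a = (-Q) ^ k := by
  obtain ⟨w, hw, hS⟩ := exists_isIntegral_hermitianSum_eq (ψ := ψ) hQ a
  have hpm : hermitianSum ψ Q a = (-Q) ^ k ∨ hermitianSum ψ Q a = -(-Q) ^ k := by
    rw [← sq_eq_sq_iff_eq_or_eq_neg, h, ← pow_mul, ← pow_mul, mul_comm, pow_mul, pow_mul, neg_sq]
  refine hpm.resolve_right fun hneg => ?_
  have hmod : (Q + 1 : ℤ) ∣ (-Q) ^ k - 1 := by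
    have := sub_dvd_pow_sub_pow (-Q : ℤ) 1 k
    rwa [one_pow, ← neg_add', neg_dvd] at this
  have hQ0 : (Q + 1 : ℂ) ≠ 0 := by exact_mod_cast Nat.succ_ne_zero Q
  have hrat : w = algebraMap ℚ ℂ ((-(-Q) ^ k - 1) / (Q + 1)) := by
    rw [hneg] at hS
    push_cast
    rw [eq_div_iff hQ0]
    linear_combination -hS
  rw [hrat, isIntegral_algebraMap_iff (algebraMap ℚ ℂ).injective] at hw
  obtain ⟨m, hm⟩ := IsIntegrallyClosed.isIntegral_iff.1 hw
  have hQ0' : (Q + 1 : ℚ) ≠ 0 := by exact_mod_cast Nat.succ_ne_zero Q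
  have hm' : -(-Q : ℤ) ^ k - 1 = (Q + 1) * m := by
    rw [eq_div_iff hQ0'] at hm
    rw [eq_intCast] at hm
    have : (-(-Q : ℚ) ^ k - 1) = (Q + 1) * m := by rw [← hm, mul_comm]
    exact_mod_cast this
  have h2 : (Q + 1 : ℤ) ∣ 2 := by
    have := (dvd_neg.2 (dvd_add hmod ⟨m, hm'⟩))
    ring_nf at this ⊢
    exact this
  have := Int.le_of_dvd two_pos h2
  omega

theorem hermitianSum_mul {γ : ℕ} (hp : Odd p) (hr : 0 < r) (hQr : Q = p ^ r)
    (hcardF : Fintype.card F = Q ^ (2 * γ)) (hcard : Fintype.card F - 1 = M * (Q ^ 2 - 1))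
    (hψ : ψ.IsPrimitive) (hfrob : ∀ x, ψ (x ^ Q) = ψ x) {a : F} (ha : a ≠ 0) :
    hermitianSum ψ Q a * (Q - 1) = (-Q) ^ γ * (Q - 1 - #(radicalUnits Q a)) := by
  have hQ1 : 1 < Q := hQr ▸ Nat.one_lt_pow hr.ne' (Fact.out : p.Prime).one_lt
  have hdvd : Q + 1 ∣ Fintype.card F - 1 := by
    rw [hcard, show Q ^ 2 - 1 = (Q + 1) * (Q - 1) by simpa using Nat.sq_sub_sq Q 1]
    exact (dvd_mul_right _ _).mul_left _
  have hsq := hermitianSum_sq hp hr hQr hcard hψ hfrob ha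
  rw [hcardF] at hsq
  rcases card_radicalUnits hQ1 hcard a with h | h <;> rw [h] at hsq ⊢
  · rw [hermitianSum_eq_neg_pow (k := γ) hQ1 hdvd]
    · push_cast; ring
    · rw [hsq]; push_cast; ring
  · rw [Nat.cast_sub (Nat.one_le_pow _ _ (by omega))] at hsq ⊢
    rw [hermitianSum_eq_neg_pow (k := γ + 1) hQ1 hdvd]
    · push_cast; ring
    · rw [hsq]; push_cast; ring

theorem sum_mulChar_mul_hermitianSum {χ : MulChar F ℂ} (hχ1 : χ ≠ 1) (hχ : χ ^ (Q + 1) = 1) :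
    ∑ a, χ a * hermitianSum ψ Q a = (Fintype.card F - 1) * gaussSum χ ψ := by
  simp_rw [hermitianSum, mul_sum]
  rw [sum_comm]
  have hx (x : F) : ∑ a, χ a * ψ (a * x ^ (Q + 1)) = if x = 0 then 0 else gaussSum χ ψ := by
    split_ifs with h
    · simp [h, MulChar.sum_eq_zero_of_ne_one hχ1]
    · have hx : χ (x ^ (Q + 1)) = 1 := by
        rw [map_pow, ← MulChar.pow_apply' _ (Nat.succ_ne_zero Q), hχ, MulChar.one_apply (Ne.isUnit h)]
      rw [gaussSum, ← Equiv.sum_comp (Equiv.mulRight₀ (x ^ (Q + 1)) (pow_ne_zero _ h))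
        (fun a => χ a * ψ a)]
      simp only [Equiv.mulRight₀_apply, map_mul, hx, mul_one]
  simp_rw [hx]
  rw [← add_sum_erase _ _ (mem_univ (0 : F)), if_pos rfl, zero_add,
    sum_congr rfl fun x hx => if_neg (ne_of_mem_erase hx), sum_const, card_erase_of_mem (mem_univ _),
    card_univ, nsmul_eq_mul, Nat.cast_sub Fintype.card_pos, Nat.cast_one]

theorem sum_mulChar_mul_card_radicalUnits {χ : MulChar F ℂ} {c : ℂ} (hQ1 : 1 < Q)
    (hχ : χ ^ (Q + 1) = 1) (hcard : #{b : F | b ^ (Q - 1) = -1} = Q - 1)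
    (hc : ∀ b, b ^ (Q - 1) = -1 → χ b = c) :
    ∑ a, χ a * #(radicalUnits Q a) = (Fintype.card F - 1) * ((Q - 1) * c) := by
  have hy (y : F) : ∑ a, χ a * (if a ^ (Q - 1) * y ^ (Q ^ 2 - 1) = -1 then 1 else 0) =
      if y = 0 then 0 else (Q - 1) * c := by
    have h1 : 1 < Q ^ 2 := Nat.one_lt_pow two_ne_zero hQ1
    split_ifs with h
    · simp [h, show Q ^ 2 - 1 ≠ 0 by omega]
    · have hy : χ (y ^ (Q + 1)) = 1 := by
        rw [map_pow, ← MulChar.pow_apply' _ (Nat.succ_ne_zero Q), hχ, MulChar.one_apply (Ne.isUnit h)]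
      calc ∑ a, χ a * (if a ^ (Q - 1) * y ^ (Q ^ 2 - 1) = -1 then 1 else 0)
          = ∑ b, χ b * (if b ^ (Q - 1) = -1 then 1 else 0) := by
            rw [← Equiv.sum_comp (Equiv.mulRight₀ (y ^ (Q + 1)) (pow_ne_zero _ h))
              (fun b => χ b * (if b ^ (Q - 1) = -1 then 1 else 0))]
            simp only [Equiv.mulRight₀_apply, map_mul, hy, mul_one, mul_pow, ← pow_mul]
            rw [show Q ^ 2 - 1 = (Q + 1) * (Q - 1) by simpa using Nat.sq_sub_sq Q 1]
        _ = ∑ b : F with b ^ (Q - 1) = -1, c := by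
            simp_rw [mul_ite, mul_one, mul_zero]
            rw [← sum_filter]
            exact sum_congr rfl fun b hb => hc b (mem_filter.1 hb).2
        _ = (Q - 1) * c := by
            rw [sum_const, hcard, nsmul_eq_mul, Nat.cast_sub hQ1.le, Nat.cast_one]
  simp_rw [radicalUnits, card_filter, Nat.cast_sum, Nat.cast_ite, Nat.cast_one, Nat.cast_zero,
    mul_sum]
  rw [sum_comm]
  simp_rw [hy]
  rw [← add_sum_erase _ _ (mem_univ (0 : F)), if_pos rfl, zero_add,
    sum_congr rfl fun x hx => if_neg (ne_of_mem_erase hx), sum_const, card_erase_of_mem (mem_univ _),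
    card_univ, nsmul_eq_mul, Nat.cast_sub Fintype.card_pos, Nat.cast_one]

/-- The semiprimitive Gauss sum: if `χ ^ (Q + 1) = 1` and `#F = Q ^ (2 * γ)`, then the Gauss sum is
`-(-Q) ^ γ` times the value of `χ` on the solutions of `b ^ (Q - 1) = -1`. -/
theorem gaussSum_eq_of_pow_eq_one {γ : ℕ} {χ : MulChar F ℂ} {c : ℂ} (hp : Odd p) (hr : 0 < r)
    (hQr : Q = p ^ r) (hcardF : Fintype.card F = Q ^ (2 * γ))
    (hcard : Fintype.card F - 1 = M * (Q ^ 2 - 1)) (hψ : ψ.IsPrimitive)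
    (hfrob : ∀ x, ψ (x ^ Q) = ψ x) (hχ1 : χ ≠ 1) (hχ : χ ^ (Q + 1) = 1)
    (hb : #{b : F | b ^ (Q - 1) = -1} = Q - 1) (hc : ∀ b, b ^ (Q - 1) = -1 → χ b = c) :
    gaussSum χ ψ = -(-Q) ^ γ * c := by
  have hQ1 : 1 < Q := hQr ▸ Nat.one_lt_pow hr.ne' (Fact.out : p.Prime).one_lt
  have hF : (Fintype.card F - 1 : ℂ) ≠ 0 :=
    sub_ne_zero.2 (by exact_mod_cast (Fintype.one_lt_card (α := F)).ne')
  have hQ : (Q - 1 : ℂ) ≠ 0 := sub_ne_zero.2 (by exact_mod_cast hQ1.ne')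
  have hterm (a : F) : χ a * hermitianSum ψ Q a * (Q - 1) =
      (-Q) ^ γ * (Q - 1) * χ a - (-Q) ^ γ * (χ a * #(radicalUnits Q a)) := by
    rcases eq_or_ne a 0 with rfl | ha
    · rw [MulChar.map_zero]; ring
    · rw [mul_assoc, hermitianSum_mul hp hr hQr hcardF hcard hψ hfrob ha]
      ring
  have hsum := congrArg (· * (Q - 1 : ℂ)) (sum_mulChar_mul_hermitianSum (ψ := ψ) hχ1 hχ)
  simp only [sum_mul, hterm, sum_sub_distrib, ← mul_sum, MulChar.sum_eq_zero_of_ne_one hχ1,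
    sum_mulChar_mul_card_radicalUnits hQ1 hχ hb hc] at hsum
  refine mul_left_cancel₀ (mul_ne_zero hF hQ) ?_
  linear_combination -hsum

end PowerSum

section Evaluation

variable {F : Type*} [Field F] [Fintype F]

theorem MulChar.isPrimitiveRoot_apply {g : F} (hg : IsPrimitiveRoot g (Fintype.card F - 1))
    (χ : MulChar F ℂ) : IsPrimitiveRoot (χ g) (orderOf χ) := by
  have hpos := card_sub_one_pos F
  have hg0 : g ≠ 0 := hg.ne_zero hpos.ne'
  refine ⟨?_, fun l hl => orderOf_dvd_of_pow_eq_one ?_⟩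
  · rw [← Units.val_mk0 hg0, ← MulChar.pow_apply_coe, pow_orderOf_eq_one, MulChar.one_apply_coe]
  · ext x
    have : NeZero (Fintype.card F - 1) := ⟨hpos.ne'⟩
    obtain ⟨i, -, hi⟩ := hg.eq_pow_of_pow_eq_one (ξ := (x : F))
      (FiniteField.pow_card_sub_one_eq_one _ x.ne_zero)
    rw [MulChar.pow_apply_coe, MulChar.one_apply_coe, ← hi, map_pow, ← pow_mul, mul_comm, pow_mul,
      hl, one_pow]

theorem IsPrimitiveRoot.pow_eq_neg_one_pow {R : Type*} [CommRing R] [IsDomain R] {ζ : R}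
    {d u m : ℕ} (hζ : IsPrimitiveRoot ζ d) (hd : 0 < d) (h : d * u = 2 * m) :
    ζ ^ m = (-1) ^ u := by
  rcases Nat.even_or_odd' d with ⟨k, rfl | rfl⟩
  · obtain rfl : m = k * u := by linarith
    rw [pow_mul, hζ.pow_half_eq_neg_one (by omega)]
  · have hu : Even u := by
      have : Even ((2 * k + 1) * u) := h ▸ even_two_mul m
      rw [Nat.even_mul] at this
      exact this.resolve_left (by simp)
    obtain ⟨v, rfl⟩ := hu
    obtain rfl : m = (2 * k + 1) * v := by linarith
    rw [pow_mul, hζ.pow_eq_one, one_pow, Even.neg_one_pow ⟨v, rfl⟩]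

theorem pow_sub_one_eq_neg_one_of_isPrimitiveRoot {Q M m : ℕ} {g : F}
    (hg : IsPrimitiveRoot g (Fintype.card F - 1)) (hcard : Fintype.card F - 1 = M * (Q ^ 2 - 1))
    (hm : Q + 1 = 2 * m) : (g ^ (M * m)) ^ (Q - 1) = -1 := by
  have e : Fintype.card F - 1 = 2 * (M * m * (Q - 1)) := by
    rw [hcard, show Q ^ 2 - 1 = (Q + 1) * (Q - 1) by simpa using Nat.sq_sub_sq Q 1, hm]
    ring
  have hpos := card_sub_one_pos F
  rw [e] at hg hpos
  rw [← pow_mul]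
  exact hg.pow_half_eq_neg_one (by omega)

theorem card_filter_pow_sub_one_eq_neg_one [DecidableEq F] {Q M : ℕ} (hQ : Odd Q)
    (hcard : Fintype.card F - 1 = M * (Q ^ 2 - 1)) : #{b : F | b ^ (Q - 1) = -1} = Q - 1 := by
  obtain ⟨g, hg⟩ := exists_isPrimitiveRoot_card_sub_one F
  obtain ⟨m, hm⟩ := hQ.add_one.two_dvd
  have hdvd : Q - 1 ∣ Fintype.card F - 1 := by
    rw [hcard, show Q ^ 2 - 1 = (Q + 1) * (Q - 1) by simpa using Nat.sq_sub_sq Q 1]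
    exact (dvd_mul_left _ _).mul_left _
  rw [← pow_sub_one_eq_neg_one_of_isPrimitiveRoot hg hcard hm]
  exact card_filter_pow_eq_pow hdvd (pow_ne_zero _ (hg.ne_zero (card_sub_one_pos F).ne'))

theorem mulChar_apply_of_pow_eq_neg_one {Q M u : ℕ} {χ : MulChar F ℂ} (hQ : Odd Q)
    (hcard : Fintype.card F - 1 = M * (Q ^ 2 - 1)) (hu : orderOf χ * u = Q + 1) {b : F}
    (hb : b ^ (Q - 1) = -1) : χ b = (-1) ^ (u * M) := by
  obtain ⟨g, hg⟩ := exists_isPrimitiveRoot_card_sub_one F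
  obtain ⟨m, hm⟩ := hQ.add_one.two_dvd
  have hpos := card_sub_one_pos F
  have hy := pow_sub_one_eq_neg_one_of_isPrimitiveRoot hg hcard hm
  have hy0 : g ^ (M * m) ≠ 0 := pow_ne_zero _ (hg.ne_zero hpos.ne')
  have e : Fintype.card F - 1 = M * (Q + 1) * (Q - 1) := by
    rw [hcard, show Q ^ 2 - 1 = (Q + 1) * (Q - 1) by simpa using Nat.sq_sub_sq Q 1, mul_assoc]
  have : NeZero (Q - 1) := ⟨by rintro h; rw [e, h] at hpos; exact absurd hpos (by simp)⟩
  obtain ⟨i, -, hi⟩ := (hg.pow hpos e).eq_pow_of_pow_eq_one (ξ := b / g ^ (M * m))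
    (by rw [div_pow, hb, hy, div_self (neg_ne_zero.2 one_ne_zero)])
  have hζ := χ.isPrimitiveRoot_apply hg
  have hζQ : χ g ^ (Q + 1) = 1 := by rw [← hu, pow_mul, hζ.pow_eq_one, one_pow]
  have hd : 0 < orderOf χ := Nat.pos_of_mul_pos_right (hu.symm ▸ Q.succ_pos : 0 < orderOf χ * u)
  rw [← div_mul_cancel₀ b hy0, ← hi, map_mul, map_pow, map_pow, map_pow, mul_comm M (Q + 1), pow_mul,
    hζQ, one_pow, one_pow, one_mul, mul_comm M m, pow_mul,
    hζ.pow_eq_neg_one_pow hd (hu.trans hm), pow_mul]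

end Evaluation

theorem neg_one_pow_geomSum_sq {Q : ℕ} (hQ : Odd Q) (γ : ℕ) :
    (-1 : ℂ) ^ (∑ i ∈ range γ, (Q ^ 2) ^ i) = (-1) ^ γ := by
  induction γ with
  | zero => simp
  | succ γ ih => rw [sum_range_succ, pow_add, ih, pow_succ (-1 : ℂ) γ, hQ.pow.pow.neg_one_pow]

section Trace

variable (p : ℕ) [Fact p.Prime] (F : Type) [Field F] [Fintype F] [CharP F p]

/-- The canonical additive character of `F`, as an `AddChar`. -/
noncomputable def traceAddChar : AddChar F ℂ :=
  letI : Algebra (ZMod p) F := ZMod.algebra F p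
  ZMod.stdAddChar.compAddMonoidHom (Algebra.trace (ZMod p) F).toAddMonoidHom

theorem traceAddChar_apply (x : F) : traceAddChar p F x = psiC p F x := by
  let _ : Algebra (ZMod p) F := ZMod.algebra F p
  change ZMod.stdAddChar (Algebra.trace (ZMod p) F x) = _
  rw [psiC, ← ZMod.natCast_zmod_val (Algebra.trace (ZMod p) F x), ← Int.cast_natCast,
    ZMod.stdAddChar_coe]
  simp

theorem traceAddChar_pow_char (x : F) : traceAddChar p F (x ^ p) = traceAddChar p F x := by
  let _ : Algebra (ZMod p) F := ZMod.algebra F p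
  change ZMod.stdAddChar (Algebra.trace (ZMod p) F (x ^ p)) =
    ZMod.stdAddChar (Algebra.trace (ZMod p) F x)
  congr 1
  have h := Algebra.trace_eq_of_algEquiv (FiniteField.frobeniusAlgEquiv (ZMod p) F p) x
  rwa [FiniteField.frobeniusAlgEquiv_apply, ZMod.card] at h

theorem traceAddChar_pow_char_pow (r : ℕ) (x : F) :
    traceAddChar p F (x ^ p ^ r) = traceAddChar p F x := by
  induction r with
  | zero => simp
  | succ r ih => rw [pow_succ, pow_mul, traceAddChar_pow_char, ih]

theorem traceAddChar_isPrimitive : (traceAddChar p F).IsPrimitive := by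
  let _ : Algebra (ZMod p) F := ZMod.algebra F p
  refine AddChar.IsPrimitive.of_ne_one (AddChar.ne_one_iff.2 ?_)
  obtain ⟨x, hx⟩ := Algebra.trace_surjective (ZMod p) F 1
  refine ⟨x, ?_⟩
  change ZMod.stdAddChar (Algebra.trace (ZMod p) F x) ≠ 1
  rw [hx, ← (ZMod.stdAddChar (N := p)).map_zero_eq_one]
  exact ZMod.injective_stdAddChar.ne one_ne_zero

end Trace

theorem pure_gauss_sum (p s n r : ℕ) [Fact p.Prime] (hp : Odd p) (hs : 0 < s) (hn : 0 < n)
    (hr : 0 < r) (q : ℕ) (hq : q = p ^ s)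
    (Fqn : Type) [Field Fqn] [Fintype Fqn] [CharP Fqn p]
    (hcardn : Fintype.card Fqn = q ^ n)
    (d : ℕ) (hd2 : 2 < d) (hdvd : d ∣ q ^ n - 1) (hdpr : d ∣ p ^ r + 1)
    (h2r : 2 * r ∣ n * s)
    (u : ℕ) (hu : u = (p ^ r + 1) / d)
    (ε : ℂ) (hε : ε = (-1 : ℂ) ^ (n * s / (2 * r)))
    (χ : MulChar Fqn ℂ) (hχ : orderOf χ = d) :
    ∀ j : ℕ, ¬ d ∣ j →
      gaussSum' p Fqn (χ ^ j)
          = -(-1 : ℂ) ^ (n * s * (u * j + 1) / (2 * r)) * (Real.sqrt q ^ n : ℝ) ∧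
      ε ^ (u * j + 1) * gaussSum' p Fqn (χ ^ j) = -(Real.sqrt q ^ n : ℝ) := by
  classical
  intro j hj
  obtain ⟨γ, hγ⟩ := h2r
  have hexp : n * s * (u * j + 1) / (2 * r) = γ * (u * j + 1) := by
    rw [hγ, mul_assoc, Nat.mul_div_cancel_left _ (by positivity)]
  have hε' : ε = (-1) ^ γ := by
    rw [hε, hγ, Nat.mul_div_cancel_left _ (by positivity)]
  have hQ1 : 1 < p ^ r := Nat.one_lt_pow hr.ne' (Fact.out : p.Prime).one_lt
  have hcardF : Fintype.card Fqn = (p ^ r) ^ (2 * γ) := by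
    rw [hcardn, hq, ← pow_mul, ← pow_mul, mul_comm s n, hγ]
    ring
  have hsqrt : Real.sqrt q ^ n = ((p ^ r : ℕ) : ℝ) ^ γ := by
    rw [← sq_eq_sq₀ (by positivity) (by positivity), ← pow_mul, mul_comm n, pow_mul,
      Real.sq_sqrt (Nat.cast_nonneg q), ← pow_mul, mul_comm γ]
    exact_mod_cast hcardn.symm.trans hcardF
  have hcard : Fintype.card Fqn - 1 =
      (∑ i ∈ range γ, ((p ^ r) ^ 2) ^ i) * ((p ^ r) ^ 2 - 1) := by
    rw [hcardF, pow_mul, geom_sum_mul_of_one_le (Nat.one_le_pow _ _ hQ1.le)]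
  have hdu : orderOf χ * u = p ^ r + 1 := by rw [hχ, hu, Nat.mul_div_cancel' hdpr]
  have hχj : χ ^ j ≠ 1 := fun h => hj (hχ ▸ orderOf_dvd_of_pow_eq_one h)
  have hχQ : (χ ^ j) ^ (p ^ r + 1) = 1 := by
    rw [← hdu, ← pow_mul, mul_comm j, mul_assoc, pow_mul, pow_orderOf_eq_one, one_pow]
  have hj0 : j ≠ 0 := by
    rintro rfl
    exact hj (dvd_zero d)
  have hc (b : Fqn) (hb : b ^ (p ^ r - 1) = -1) : (χ ^ j) b = ((-1 : ℂ) ^ γ) ^ (u * j) := by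
    rw [MulChar.pow_apply' _ hj0, mulChar_apply_of_pow_eq_neg_one hp.pow hcard hdu hb,
      mul_comm u, pow_mul (-1 : ℂ) _ u, neg_one_pow_geomSum_sq hp.pow, pow_mul _ u j]
  have hG : gaussSum' p Fqn (χ ^ j) =
      -((-1 : ℂ) ^ γ) ^ (u * j + 1) * (Real.sqrt q ^ n : ℝ) := by
    have h := gaussSum_eq_of_pow_eq_one hp hr rfl hcardF hcard (traceAddChar_isPrimitive p Fqn)
      (traceAddChar_pow_char_pow p Fqn r) hχj hχQ
      (card_filter_pow_sub_one_eq_neg_one hp.pow hcard) hc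
    have h' : gaussSum' p Fqn (χ ^ j) = gaussSum (χ ^ j) (traceAddChar p Fqn) :=
      sum_congr rfl fun x _ => by rw [traceAddChar_apply]
    rw [h', h, hsqrt, neg_pow (((p ^ r : ℕ) : ℂ))]
    push_cast
    ring
  refine ⟨by rw [hG, hexp, pow_mul], ?_⟩
  have hone : ((-1 : ℂ) ^ γ) ^ (u * j + 1) * ((-1 : ℂ) ^ γ) ^ (u * j + 1) = 1 := by
    rw [← mul_pow, ← mul_pow]
    simp
  rw [hG, hε']
  linear_combination (-(Real.sqrt q ^ n : ℝ) : ℂ) * hone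
end
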